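/- Let T be an ℝ-tree and let G be a group with a non-nesting action on T by weak homeomorphisms. If g, h ∈ G are such that g, h and gh are all elliptic, then T^g ∩ T^h ∩ T^{gh} ≠ ∅, i.e. g, h and gh have a common fixed point. -/

import Mathlib

open Set

/-- A topologically embedded arc in `T` joining `x` to `y`, given as a subset:
the image of a continuous injective map on `[0,1]` with endpoints `x` and `y`
(such a map is automatically a topological embedding). -/
def IsArc {T : Type*} [MetricSpace T] (A : Set T) (x y : T) : Prop :=
  ∃ f : ℝ → T, ContinuousOn f (Icc (0 : ℝ) 1) ∧ InjOn f (Icc (0 : ℝ) 1) ∧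
    f '' Icc (0 : ℝ) 1 = A ∧ f 0 = x ∧ f 1 = y

/-- `A ⊆ T` is isometric to a closed bounded interval of `ℝ`. -/
def IsIsometricToInterval {T : Type*} [MetricSpace T] (A : Set T) : Prop :=
  ∃ (a b : ℝ) (f : ℝ → T), a ≤ b ∧
    (∀ s ∈ Icc a b, ∀ t ∈ Icc a b, dist (f s) (f t) = |s - t|) ∧
    f '' Icc a b = A

/-- An `ℝ`-tree: a metric space in which any two distinct points are joined by a
unique topologically embedded arc, and this arc is isometric to a closed bounded
interval of `ℝ`. -/
structure IsRTree (T : Type*) [MetricSpace T] : Prop where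
  arc_existsUnique : ∀ ⦃x y : T⦄, x ≠ y → ∃! A : Set T, IsArc A x y
  arc_isometric : ∀ ⦃x y : T⦄, x ≠ y → ∀ A : Set T, IsArc A x y → IsIsometricToInterval A

open scoped Classical in
/-- The segment `[x,y]`: the unique arc joining `x` to `y` if `x ≠ y`
(computed as the intersection of all such arcs), and `{x}` if `x = y`. -/
noncomputable def seg {T : Type*} [MetricSpace T] (x y : T) : Set T :=
  if x = y then {x} else ⋂₀ {A : Set T | IsArc A x y}

/-- Betweenness: `Btwn x y z` iff `x ∈ [y,z] \ {y,z}`. -/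
def Btwn {T : Type*} [MetricSpace T] (x y z : T) : Prop :=
  x ∈ seg y z ∧ x ≠ y ∧ x ≠ z

/-- A weak homeomorphism of `T`: a bijection preserving the betweenness relation. -/
def IsWeakHomeo {T : Type*} [MetricSpace T] (g : T → T) : Prop :=
  Function.Bijective g ∧ ∀ x y z : T, Btwn x y z ↔ Btwn (g x) (g y) (g z)

/-- Convex subsets (subtrees) of `T`. -/
def ConvexSubtree {T : Type*} [MetricSpace T] (S : Set T) : Prop :=
  ∀ x ∈ S, ∀ y ∈ S, seg x y ⊆ S

/-- The action of `G` on `T` is by weak homeomorphisms. -/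
def ActsByWeakHomeos (G T : Type*) [Group G] [MulAction G T] [MetricSpace T] : Prop :=
  ∀ g : G, IsWeakHomeo (fun t : T => g • t)

/-- The action of `G` on `T` is non-nesting: no segment is mapped properly into itself. -/
def NonNesting (G T : Type*) [Group G] [MulAction G T] [MetricSpace T] : Prop :=
  ∀ (g : G) (x y : T), ¬ ((fun t : T => g • t) '' seg x y ⊂ seg x y)

/-- The fixed-point set `T^g` of a group element. -/
def fixedSet (T : Type*) {G : Type*} [Group G] [MulAction G T] (g : G) : Set T :=
  {t : T | g • t = t}

/-- `x, y, z` span a tripod: the median of `x, y, z` lies in none of `{x,y,z}`. -/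
def IsTripod {T : Type*} [MetricSpace T] (x y z : T) : Prop :=
  ∀ c ∈ seg x y ∩ seg y z ∩ seg z x, c ≠ x ∧ c ≠ y ∧ c ≠ z

/-- `S` contains no tripod. -/
def NoTripod {T : Type*} [MetricSpace T] (S : Set T) : Prop :=
  ¬ ∃ x y z : T, IsTripod x y z ∧ seg x y ∪ seg y z ∪ seg z x ⊆ S

/-- A line: a convex subset containing no tripod, maximal for inclusion. -/
def IsLine {T : Type*} [MetricSpace T] (L : Set T) : Prop :=
  ConvexSubtree L ∧ NoTripod L ∧
    ∀ L' : Set T, ConvexSubtree L' → NoTripod L' → L ⊆ L' → L' = L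

/-- `L` is an axis for `g`: a `g`-invariant line. -/
def IsAxis {G T : Type*} [Group G] [MulAction G T] [MetricSpace T] (g : G) (L : Set T) :
    Prop :=
  IsLine L ∧ (fun t : T => g • t) '' L = L


/-- Metric betweenness: `p` lies on a geodesic from `x` to `y`. -/
def MB {T : Type*} [MetricSpace T] (x p y : T) : Prop :=
  dist x p + dist p y = dist x y

theorem arc_of_geod {T : Type*} [MetricSpace T] (f : ℝ → T) (a b : ℝ) (hab : a ≠ b)
    (hf : ContinuousOn f (uIcc a b)) (hi : InjOn f (uIcc a b)) :
    IsArc (f '' uIcc a b) (f a) (f b) := by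
  have himg : (fun t : ℝ => a + t * (b - a)) '' Icc (0 : ℝ) 1 = uIcc a b := by
    rw [← segment_eq_uIcc, segment_eq_image']
    rfl
  have hmap : MapsTo (fun t : ℝ => a + t * (b - a)) (Icc (0 : ℝ) 1) (uIcc a b) := by
    rw [← himg]; exact mapsTo_image _ _
  refine ⟨fun t => f (a + t * (b - a)), ?_, ?_, ?_, by simp, by simp⟩
  · exact hf.comp (by fun_prop) hmap
  · intro s hs t ht hst
    have h1 := hi (hmap hs) (hmap ht) hst
    have h2 : b - a ≠ 0 := sub_ne_zero.mpr (Ne.symm hab)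
    have h3 : s * (b - a) = t * (b - a) := by simpa using h1
    exact mul_right_cancel₀ h2 h3
  · rw [← himg, image_image]

theorem seg_eq_arc {T : Type*} [MetricSpace T] (hT : IsRTree T) {x y : T} (hxy : x ≠ y)
    {A : Set T} (hA : IsArc A x y) : seg x y = A := by
  unfold seg
  rw [if_neg hxy]
  obtain ⟨B, hB, hu⟩ := hT.arc_existsUnique hxy
  have : {A : Set T | IsArc A x y} = {A} := by
    ext C
    simp only [mem_setOf_eq, mem_singleton_iff]
    constructor
    · intro hC
      rw [hu C hC, hu A hA]
    · rintro rfl; exact hA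
  rw [this, sInter_singleton]

theorem geod_exists {T : Type*} [MetricSpace T] (hT : IsRTree T) (x y : T) :
    ∃ f : ℝ → T, f 0 = x ∧ f (dist x y) = y ∧
      (∀ s ∈ Icc 0 (dist x y), ∀ t ∈ Icc 0 (dist x y), dist (f s) (f t) = |s - t|) ∧
      f '' Icc 0 (dist x y) = seg x y := by
  by_cases hxy : x = y
  · subst hxy
    refine ⟨fun _ => x, rfl, rfl, ?_, ?_⟩
    · intro s hs t ht
      simp only [dist_self, Icc_self, mem_singleton_iff] at hs ht
      subst hs; subst ht; simp
    · simp [seg]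
  obtain ⟨A, hA, hu⟩ := hT.arc_existsUnique hxy
  obtain ⟨a, b, f, hab, hf, himg⟩ := hT.arc_isometric hxy A hA
  have hx : x ∈ A := by
    obtain ⟨φ, _, _, h3, h4, _⟩ := hA
    rw [← h3]; exact ⟨0, by simp, h4⟩
  have hy : y ∈ A := by
    obtain ⟨φ, _, _, h3, _, h4⟩ := hA
    rw [← h3]; exact ⟨1, by simp, h4⟩
  rw [← himg] at hx hy
  obtain ⟨s, hs, rfl⟩ := hx
  obtain ⟨t, ht, rfl⟩ := hy
  have hst : s ≠ t := fun h => hxy (by rw [h])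
  have hsub : uIcc s t ⊆ Icc a b := by
    intro r hr
    rw [mem_uIcc] at hr
    rcases hr with hr | hr
    · exact ⟨hs.1.trans hr.1, hr.2.trans ht.2⟩
    · exact ⟨ht.1.trans hr.1, hr.2.trans hs.2⟩
  have hcont : ContinuousOn f (Icc a b) := by
    have : LipschitzOnWith 1 f (Icc a b) := by
      apply LipschitzOnWith.of_dist_le_mul
      intro u hu v hv
      rw [hf u hu v hv, Real.dist_eq]; simp
    exact this.continuousOn
  have hinj : InjOn f (Icc a b) := by
    intro u hu v hv huv
    have := hf u hu v hv
    rw [huv, dist_self] at this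
    have := abs_eq_zero.mp this.symm
    linarith
  have harc := arc_of_geod f s t hst (hcont.mono hsub) (hinj.mono hsub)
  have hseg := seg_eq_arc hT hxy harc
  rw [hseg, hf s hs t ht]
  have himage : ∀ ε : ℝ, (t - s = ε * |s - t|) → ε * ε = 1 →
      (fun r => s + ε * r) '' Icc 0 |s - t| = uIcc s t := by
    intro ε h1 h2
    have h0 : ε = 1 ∨ ε = -1 := by
      apply mul_self_eq_one_iff.mp h2
    have habs := abs_nonneg (s - t)
    ext r
    simp only [mem_image, mem_Icc, mem_uIcc]
    rcases h0 with rfl | rfl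
    · constructor
      · rintro ⟨u, hu, rfl⟩
        left; constructor <;> linarith
      · rintro (hr | hr)
        · exact ⟨r - s, ⟨by linarith, by linarith⟩, by ring⟩
        · exact ⟨r - s, ⟨by linarith, by linarith⟩, by ring⟩
    · constructor
      · rintro ⟨u, hu, rfl⟩
        right; constructor <;> linarith
      · rintro (hr | hr)
        · exact ⟨s - r, ⟨by linarith, by linarith⟩, by ring⟩
        · exact ⟨s - r, ⟨by linarith, by linarith⟩, by ring⟩
  obtain ⟨ε, h1, h2⟩ : ∃ ε : ℝ, (t - s = ε * |s - t|) ∧ ε * ε = 1 := by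
    rcases le_total s t with h | h
    · exact ⟨1, by rw [abs_of_nonpos (by linarith)]; ring, by ring⟩
    · exact ⟨-1, by rw [abs_of_nonneg (by linarith)]; ring, by ring⟩
  have him := himage ε h1 h2
  have hmem : ∀ r ∈ Icc 0 |s - t|, s + ε * r ∈ Icc a b := by
    intro r hr
    apply hsub
    rw [← him]
    exact ⟨r, hr, rfl⟩
  refine ⟨fun r => f (s + ε * r), by simp, ?_, ?_, ?_⟩
  · show f (s + ε * |s - t|) = f t
    rw [← h1]; congr 1; ring
  · intro u hu v hv
    rw [hf _ (hmem u hu) _ (hmem v hv)]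
    have : s + ε * u - (s + ε * v) = ε * (u - v) := by ring
    rw [this, abs_mul]
    have : |ε| = 1 := by
      rcases mul_self_eq_one_iff.mp h2 with rfl | rfl <;> simp
    rw [this, one_mul]
  · rw [← him, image_image]

theorem MB_of_mem_seg {T : Type*} [MetricSpace T] (hT : IsRTree T) {x y p : T}
    (hp : p ∈ seg x y) : MB x p y := by
  obtain ⟨f, h0, h1, hf, him⟩ := geod_exists hT x y
  rw [← him] at hp
  obtain ⟨r, hr, rfl⟩ := hp
  have hD : (0:ℝ) ≤ dist x y := dist_nonneg
  have e1 := hf 0 ⟨le_rfl, hD⟩ r hr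
  have e2 := hf r hr (dist x y) ⟨hD, le_rfl⟩
  rw [h0] at e1
  rw [h1] at e2
  unfold MB
  rw [e1, e2, abs_of_nonpos (by linarith [hr.1]), abs_of_nonpos (by linarith [hr.2])]
  ring

theorem seg_concat {T : Type*} [MetricSpace T] (hT : IsRTree T) {x p y : T}
    (h : ∀ q, q ∈ seg x p → q ∈ seg p y → q = p) : p ∈ seg x y := by
  obtain ⟨f, f0, f1, hf, fim⟩ := geod_exists hT x p
  obtain ⟨k, k0, k1, hk, kim⟩ := geod_exists hT p y
  have hD : (0:ℝ) ≤ dist x p := dist_nonneg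
  have hE : (0:ℝ) ≤ dist p y := dist_nonneg
  set D := dist x p with hDdef
  set E := dist p y with hEdef
  by_cases hDE : D + E = 0
  · have h1 : x = p := dist_eq_zero.mp (by linarith)
    have h2 : p = y := dist_eq_zero.mp (by linarith)
    subst h1; subst h2
    simp [seg]
  have hpos : 0 < D + E := lt_of_le_of_ne (by linarith) (Ne.symm hDE)
  let φ : ℝ → T := fun r => if r ≤ D then f r else k (r - D)
  have φ1 : ∀ r ∈ Icc 0 D, φ r = f r := fun r hr => if_pos hr.2
  have φ2 : ∀ r ∈ Icc D (D + E), φ r = k (r - D) := by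
    intro r hr
    by_cases hrD : r ≤ D
    · have : r = D := le_antisymm hrD hr.1
      subst this
      simp only [φ, le_refl, if_true, sub_self]
      rw [f1, k0]
    · exact if_neg hrD
  have c1 : ∀ u ∈ Icc 0 D, ∀ v ∈ Icc 0 D, dist (φ u) (φ v) = |u - v| := by
    intro u hu v hv
    rw [φ1 u hu, φ1 v hv, hf u hu v hv]
  have c2 : ∀ u ∈ Icc D (D + E), ∀ v ∈ Icc D (D + E), dist (φ u) (φ v) = |u - v| := by
    intro u hu v hv
    rw [φ2 u hu, φ2 v hv, hk _ ⟨by linarith [hu.1], by linarith [hu.2]⟩ _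
      ⟨by linarith [hv.1], by linarith [hv.2]⟩]
    congr 1; ring
  have hcross : ∀ u ∈ Icc 0 D, ∀ v ∈ Icc D (D + E), φ u = φ v → u = v := by
    intro u hu v hv huv
    have m1 : φ u ∈ seg x p := by rw [φ1 u hu, ← fim]; exact ⟨u, hu, rfl⟩
    have m2 : φ u ∈ seg p y := by
      rw [huv, φ2 v hv, ← kim]
      exact ⟨v - D, ⟨by linarith [hv.1], by linarith [hv.2]⟩, rfl⟩
    have e := h _ m1 m2
    have hDD : φ D = p := by rw [φ1 D ⟨hD, le_rfl⟩, f1]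
    have d1 := c1 u hu D ⟨hD, le_rfl⟩
    have d2 := c2 v hv D ⟨le_rfl, by linarith⟩
    rw [e, hDD, dist_self] at d1
    rw [← huv, e, hDD, dist_self] at d2
    have := abs_eq_zero.mp d1.symm
    have := abs_eq_zero.mp d2.symm
    linarith
  have hinj : InjOn φ (Icc 0 (D + E)) := by
    intro u hu v hv huv
    rcases le_total u D with h1 | h1 <;> rcases le_total v D with h2 | h2
    · have := c1 u ⟨hu.1, h1⟩ v ⟨hv.1, h2⟩
      rw [huv, dist_self] at this
      linarith [abs_eq_zero.mp this.symm]
    · exact hcross u ⟨hu.1, h1⟩ v ⟨h2, hv.2⟩ huv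
    · exact (hcross v ⟨hv.1, h2⟩ u ⟨h1, hu.2⟩ huv.symm).symm
    · have := c2 u ⟨h1, hu.2⟩ v ⟨h2, hv.2⟩
      rw [huv, dist_self] at this
      linarith [abs_eq_zero.mp this.symm]
  have hcont : ContinuousOn φ (Icc 0 (D + E)) := by
    rw [← Icc_union_Icc_eq_Icc hD (by linarith : D ≤ D + E)]
    have l1 : LipschitzOnWith 1 φ (Icc 0 D) := by
      apply LipschitzOnWith.of_dist_le_mul
      intro u hu v hv
      rw [c1 u hu v hv, Real.dist_eq]; simp
    have l2 : LipschitzOnWith 1 φ (Icc D (D + E)) := by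
      apply LipschitzOnWith.of_dist_le_mul
      intro u hu v hv
      rw [c2 u hu v hv, Real.dist_eq]; simp
    exact l1.continuousOn.union_of_isClosed l2.continuousOn isClosed_Icc isClosed_Icc
  have hu : uIcc 0 (D + E) = Icc 0 (D + E) := uIcc_of_le hpos.le
  have harc := arc_of_geod φ 0 (D + E) hpos.ne (by rwa [hu]) (by rwa [hu])
  have e0 : φ 0 = x := by rw [φ1 0 ⟨le_rfl, hD⟩, f0]
  have e1 : φ (D + E) = y := by
    rw [φ2 _ ⟨by linarith, le_rfl⟩, add_sub_cancel_left, k1]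
  have hne : φ 0 ≠ φ (D + E) := by
    intro heq
    exact hpos.ne (hinj ⟨le_rfl, hpos.le⟩ ⟨hpos.le, le_rfl⟩ heq)
  have := seg_eq_arc hT hne harc
  rw [e0, e1, hu] at this
  rw [this]
  exact ⟨D, ⟨hD, by linarith⟩, by rw [φ1 D ⟨hD, le_rfl⟩, f1]⟩

theorem mem_seg_iff {T : Type*} [MetricSpace T] (hT : IsRTree T) {x y p : T} :
    p ∈ seg x y ↔ MB x p y := by
  refine ⟨MB_of_mem_seg hT, fun h => seg_concat hT ?_⟩
  intro q h1 h2
  have h1 := MB_of_mem_seg hT h1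
  have h2 := MB_of_mem_seg hT h2
  unfold MB at *
  apply dist_le_zero.mp
  have := dist_triangle x q y
  rw [dist_comm p q] at h2
  linarith

section MBlemmas
variable {T : Type*} [MetricSpace T]

theorem MB.symm {x p y : T} (h : MB x p y) : MB y p x := by
  unfold MB at *
  rw [dist_comm y p, dist_comm p x, dist_comm y x]; linarith

theorem MB.left (x y : T) : MB x x y := by simp [MB]
theorem MB.right (x y : T) : MB x y y := by simp [MB]

/-- `x q p y` : from `q ∈ [x,p]`, `p ∈ [x,y]`. -/
theorem MB.trans {x q p y : T} (h1 : MB x q p) (h2 : MB x p y) : MB x q y ∧ MB q p y := by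
  unfold MB at *
  have a1 := dist_triangle x q y
  have a2 := dist_triangle q p y
  constructor <;> linarith

/-- from `p ∈ [x,y]`, `q ∈ [p,y]`. -/
theorem MB.trans' {x p q y : T} (h1 : MB x p y) (h2 : MB p q y) : MB x q y ∧ MB x p q := by
  have := MB.trans h2.symm h1.symm
  exact ⟨this.1.symm, this.2.symm⟩

theorem MB.antisymm {x p q : T} (h1 : MB x p q) (h2 : MB x q p) : p = q := by
  unfold MB at *
  apply dist_le_zero.mp
  rw [dist_comm q p] at h2
  linarith

theorem MB.linear (hT : IsRTree T) {x p q y : T} (h1 : MB x p y) (h2 : MB x q y) :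
    MB x p q ∨ MB x q p := by
  obtain ⟨f, f0, f1, hf, fim⟩ := geod_exists hT x y
  rw [← mem_seg_iff hT, ← fim] at h1 h2
  obtain ⟨r, hr, rfl⟩ := h1
  obtain ⟨s, hs, rfl⟩ := h2
  have h0 : (0:ℝ) ∈ Icc 0 (dist x y) := ⟨le_rfl, dist_nonneg⟩
  have e1 := hf 0 h0 r hr
  have e2 := hf 0 h0 s hs
  have e3 := hf r hr s hs
  have e4 := hf s hs r hr
  rw [f0, abs_of_nonpos (by linarith [hr.1])] at e1
  rw [f0, abs_of_nonpos (by linarith [hs.1])] at e2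
  unfold MB
  rcases le_total r s with h | h
  · left
    rw [e1, e2, e3, abs_of_nonpos (by linarith)]; ring
  · right
    rw [e1, e2, e4, abs_of_nonpos (by linarith)]; ring

theorem median_exists (hT : IsRTree T) (x y z : T) :
    ∃ m, MB x m y ∧ MB x m z ∧ MB y m z := by
  obtain ⟨f, f0, f1, hf, fim⟩ := geod_exists hT x y
  have hcomp : IsCompact (seg x y) := by
    rw [← fim]
    apply isCompact_Icc.image_of_continuousOn
    have : LipschitzOnWith 1 f (Icc 0 (dist x y)) := by
      apply LipschitzOnWith.of_dist_le_mul
      intro u hu v hv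
      rw [hf u hu v hv, Real.dist_eq]; simp
    exact this.continuousOn
  have hcl : IsClosed {p | MB x p z} :=
    isClosed_eq (by fun_prop) (by fun_prop)
  obtain ⟨m, ⟨hm1, hm2⟩, hmax⟩ := (hcomp.inter_right hcl).exists_isMaxOn
    ⟨x, (mem_seg_iff hT).mpr (MB.left x y), MB.left x z⟩
    (f := fun p => dist x p) (by fun_prop)
  have hm1 := (mem_seg_iff hT).mp hm1
  have hm2 : MB x m z := hm2
  refine ⟨m, hm1, hm2, ?_⟩
  rw [← mem_seg_iff hT]
  apply seg_concat hT
  intro q h1 h2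
  have h1 := ((mem_seg_iff hT).mp h1).symm
  have h2 := (mem_seg_iff hT).mp h2
  have a1 := MB.trans' hm1 h1
  have a2 := MB.trans' hm2 h2
  have := hmax ⟨(mem_seg_iff hT).mpr a1.1, a2.1⟩
  have this : dist x q ≤ dist x m := this
  have b := a1.2
  unfold MB at b
  apply (dist_le_zero.mp _).symm
  linarith

variable {G : Type*} [Group G] [MulAction G T]

theorem MB.smul (hT : IsRTree T) (hact : ActsByWeakHomeos G T) (k : G) {x p y : T}
    (h : MB x p y) : MB (k • x) (k • p) (k • y) := by
  by_cases h1 : p = x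
  · subst h1; exact MB.left _ _
  by_cases h2 : p = y
  · subst h2; exact MB.right _ _
  have := ((hact k).2 p x y).mp ⟨(mem_seg_iff hT).mpr h, h1, h2⟩
  exact (mem_seg_iff hT).mp this.1

theorem inv_fix {k : G} {a : T} (h : k • a = a) : k⁻¹ • a = a := by
  rw [inv_smul_eq_iff, h]

theorem NN1 (hT : IsRTree T) (hact : ActsByWeakHomeos G T) (hnn : NonNesting G T)
    {k : G} {a b : T} (ha : k • a = a) (h : MB a (k • b) b) : k • b = b := by
  by_contra hne
  apply hnn k a b
  constructor
  · rintro _ ⟨p, hp, rfl⟩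
    have := ((mem_seg_iff hT).mp hp).smul hT hact k
    rw [ha] at this
    exact (mem_seg_iff hT).mpr (MB.trans this h).1
  · intro hsub
    obtain ⟨p, hp, hpb⟩ := hsub ((mem_seg_iff hT).mpr (MB.right a b))
    have := ((mem_seg_iff hT).mp hp).smul hT hact k
    have hpb : k • p = b := hpb
    rw [ha, hpb] at this
    exact hne (h.antisymm this)

theorem NN2 (hT : IsRTree T) (hact : ActsByWeakHomeos G T) (hnn : NonNesting G T)
    {k : G} {a b : T} (ha : k • a = a) (h : MB a b (k • b)) : k • b = b := by
  have := h.smul hT hact k⁻¹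
  rw [inv_fix ha, inv_smul_smul] at this
  have := NN1 hT hact hnn (inv_fix ha) this
  rw [inv_smul_eq_iff] at this
  exact this.symm

theorem last_fixed (hT : IsRTree T) (hact : ActsByWeakHomeos G T) (hnn : NonNesting G T)
    {k : G} {x : T} (y : T) (hx : k • x = x) :
    ∃ c, k • c = c ∧ MB x c y ∧ ∀ p, MB c p y → k • p = p → p = c := by
  obtain ⟨f, f0, f1, hf, fim⟩ := geod_exists hT x y
  set S : Set ℝ := {r | r ∈ Icc 0 (dist x y) ∧ k • f r = f r} with hS
  have hne : S.Nonempty := ⟨0, ⟨le_rfl, dist_nonneg⟩, by rw [f0, hx]⟩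
  have hbd : BddAbove S := ⟨dist x y, fun r hr => hr.1.2⟩
  have hs : sSup S ∈ Icc 0 (dist x y) :=
    ⟨le_csSup hbd ⟨⟨le_rfl, dist_nonneg⟩, by rw [f0, hx]⟩, csSup_le hne fun r hr => hr.1.2⟩
  have h0 : (0:ℝ) ∈ Icc 0 (dist x y) := ⟨le_rfl, dist_nonneg⟩
  have dx : ∀ r ∈ Icc 0 (dist x y), dist x (f r) = r := by
    intro r hr
    have := hf 0 h0 r hr
    rw [f0, abs_of_nonpos (by linarith [hr.1])] at this
    linarith
  refine ⟨f (sSup S), ?_, ?_, ?_⟩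
  · apply NN2 hT hact hnn hx
    unfold MB
    apply le_antisymm _ (dist_triangle _ _ _)
    apply le_of_forall_pos_le_add
    intro ε hε
    obtain ⟨r, hr, hlt⟩ := exists_lt_of_lt_csSup hne (show sSup S - ε / 2 < sSup S by linarith)
    have hle : r ≤ sSup S := le_csSup hbd hr
    have e := hf r hr.1 _ hs
    rw [abs_of_nonpos (by linarith)] at e
    have m : MB x (f r) (f (sSup S)) := by
      unfold MB
      rw [e, dx r hr.1, dx _ hs]; ring
    have m2 := m.smul hT hact k
    rw [hx, hr.2] at m2
    unfold MB at m m2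
    have t1 := dist_triangle (f (sSup S)) (f r) (k • f (sSup S))
    rw [dist_comm (f (sSup S)) (f r)] at t1
    linarith
  · rw [← mem_seg_iff hT, ← fim]; exact ⟨_, hs, rfl⟩
  · intro p hp hkp
    have hc : MB x (f (sSup S)) y := by
      rw [← mem_seg_iff hT, ← fim]; exact ⟨_, hs, rfl⟩
    obtain ⟨a1, a2⟩ := MB.trans' hc hp
    rw [← mem_seg_iff hT, ← fim] at a1
    obtain ⟨r, hr, rfl⟩ := a1
    have : r ≤ sSup S := le_csSup hbd ⟨hr, hkp⟩
    unfold MB at a2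
    rw [dx r hr, dx _ hs] at a2
    apply (dist_le_zero.mp _).symm
    linarith

theorem claimA (hT : IsRTree T) (hact : ActsByWeakHomeos G T) (hnn : NonNesting G T)
    {k : G} {d c : T} (hd : k • d = d) (hl : ∀ p, MB d p c → k • p = p → p = d)
    {u : T} (h1 : MB d u c) (h2 : MB d u (k • c)) : u = d := by
  have h3 := h2.smul hT hact k⁻¹
  rw [inv_fix hd, inv_smul_smul] at h3
  have key : k • (k⁻¹ • u) = k⁻¹ • u := by
    rcases MB.linear hT h1 h3 with h | h
    · exact NN1 hT hact hnn hd (by rwa [smul_inv_smul])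
    · exact NN2 hT hact hnn hd (by rwa [smul_inv_smul])
  rw [smul_inv_smul] at key
  apply hl u h1
  rw [← inv_smul_eq_iff.mp key.symm]

theorem claimB (hT : IsRTree T) (hact : ActsByWeakHomeos G T) (hnn : NonNesting G T)
    {k : G} {d c : T} (hd : k • d = d) (hl : ∀ p, MB d p c → k • p = p → p = d)
    {z p q : T} (p1 : MB d p c) (p2 : MB d p z) (hp : p ≠ d)
    (q1 : MB d q c) (q2 : MB d q (k • z)) : q = d := by
  have a1 := p1.smul hT hact k
  have a2 := p2.smul hT hact k
  rw [hd] at a1 a2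
  rcases MB.linear hT q2 a2 with h | h
  · exact claimA hT hact hnn hd hl q1 (MB.trans h a1).1
  · exfalso
    have := claimA hT hact hnn hd hl (MB.trans h q1).1 a1
    apply hp
    rw [← inv_smul_smul k p, this, inv_fix hd]

end MBlemmas

/-- For a non-nesting action by weak homeomorphisms on an `ℝ`-tree,
if `g`, `h` and `g * h` are all elliptic, then they have a common fixed point. -/
theorem common_fixed_point_of_elliptic
    {T : Type*} [MetricSpace T] (hT : IsRTree T)
    {G : Type*} [Group G] [MulAction G T]
    (hact : ActsByWeakHomeos G T) (hnn : NonNesting G T)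
    (g h : G) (hg : ∃ t : T, g • t = t) (hh : ∃ t : T, h • t = t)
    (hgh : ∃ t : T, (g * h) • t = t) :
    ∃ t : T, g • t = t ∧ h • t = t ∧ (g * h) • t = t := by
  obtain ⟨x, hx⟩ := hg
  obtain ⟨y, hy⟩ := hh
  obtain ⟨z, hz⟩ := hgh
  obtain ⟨c, hc, hcm, hcl⟩ := last_fixed hT hact hnn y hx
  obtain ⟨d, hd, hdm, hdl⟩ := last_fixed hT hact hnn c hy
  by_cases hcd : c = d
  · subst hcd
    exact ⟨c, hc, hd, by rw [mul_smul, hd, hc]⟩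
  exfalso
  have hcl' : ∀ p, MB c p d → g • p = p → p = c := fun p hp =>
    hcl p (MB.trans hp hdm.symm).1
  have inv_of : ∀ (k : G) (p : T), k⁻¹ • p = p → k • p = p := by
    intro k p hp
    have := inv_fix hp
    rwa [inv_inv] at this
  have hcli : ∀ p, MB c p d → g⁻¹ • p = p → p = c := fun p hp h =>
    hcl' p hp (inv_of g p h)
  have hdli : ∀ p, MB d p c → h⁻¹ • p = p → p = d := fun p hp h' =>
    hdl p hp (inv_of h p h')
  obtain ⟨w, hw⟩ : ∃ w, w = h • z := ⟨_, rfl⟩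
  have hgw : g • w = z := by rw [hw, ← mul_smul, hz]
  have hgz : g⁻¹ • z = w := by rw [← hgw, inv_smul_smul]
  have hhw : h⁻¹ • w = z := by rw [hw, inv_smul_smul]
  obtain ⟨p, p1, p2, p3⟩ := median_exists hT c d z
  obtain ⟨q, q1, q2, q3⟩ := median_exists hT c d w
  have i1 : p ≠ d → q = d := fun hp =>
    claimB hT hact hnn hd hdl p1.symm p3 hp q1.symm (by rwa [← hw])
  have i2 : q ≠ c → p = c := fun hq =>
    claimB hT hact hnn hc hcl' q1 q2 hq p1 (by rwa [hgw])
  have i3 : p ≠ c → q = c := fun hp =>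
    claimB hT hact hnn (inv_fix hc) hcli p1 p2 hp q1 (by rwa [hgz])
  by_cases hpd : p = d
  · have hqc : q = c := i3 (by rw [hpd]; exact Ne.symm hcd)
    subst hpd; subst hqc
    -- order w, q, p, z
    have a1 := q3.smul hT hact h⁻¹
    rw [inv_fix hd, hhw] at a1
    -- a1 : h⁻¹ q ∈ [p,z]
    have hk : (g * h)⁻¹ • q = h⁻¹ • q := by
      rw [mul_inv_rev, mul_smul, inv_fix hc]
    have a2 := MB.trans' p2 a1
    have := NN1 hT hact hnn (k := (g * h)⁻¹) (a := z) (b := q) (inv_fix hz)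
      (by rw [hk]; exact a2.1.symm)
    rw [hk] at this
    rw [this] at a1
    exact hcd (p2.symm.antisymm a1.symm).symm
  · have hqd := i1 hpd
    have hpc : p = c := i2 (by rw [hqd]; exact Ne.symm hcd)
    subst hpc; subst hqd
    -- order z, p, q, w
    have a1 := p3.smul hT hact h
    rw [hd, ← hw] at a1
    -- a1 : h p ∈ [q,w]
    have a2 := MB.trans' q2 a1
    have a3 := a2.1.smul hT hact g
    rw [hc, hgw, ← mul_smul] at a3
    have := NN1 hT hact hnn hz a3.symm
    have e : h • p = p := by
      rw [mul_smul] at this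
      rw [← inv_smul_smul g (h • p), this, inv_fix hc]
    rw [e] at a1
    exact hcd (q2.symm.antisymm a1.symm).symm
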